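/- For every finite abstract simplicial complex G of maximal dimension 1 (i.e., every set in G has at most 2 elements and at least one set has exactly 2 elements), the average simplex cardinalities of the iterated Barycentric refinements converge: Dim⁺(G_n) → 3/2 as n → ∞. -/

import Mathlib

/-- A finite abstract simplicial complex: a finite collection of nonempty finite
subsets of the vertex type, closed under taking nonempty subsets. -/
def IsComplex (G : Finset (Finset ℕ)) : Prop :=
  (∀ x ∈ G, x.Nonempty) ∧ ∀ x ∈ G, ∀ y ⊆ x, y.Nonempty → y ∈ G

/-- The average simplex cardinality `Dim⁺(G) = (∑_{x ∈ G} |x|) / (|G| + 1)`. -/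
def DimPlus (G : Finset (Finset ℕ)) : ℚ :=
  (∑ x ∈ G, (x.card : ℚ)) / (G.card + 1)

/-- An injective encoding of finite sets of naturals as naturals (binary
expansion), used to relabel the vertices of the Barycentric refinement. -/
def enc (s : Finset ℕ) : ℕ := ∑ i ∈ s, 2 ^ i

/-- The Barycentric refinement of `G`: its simplices are the nonempty sets of
simplices of `G` whose elements are pairwise comparable by inclusion; the new
vertices (simplices of `G`) are relabelled by the injective encoding `enc`. -/
def bary (G : Finset (Finset ℕ)) : Finset (Finset ℕ) :=
  (G.powerset.filter fun A => A.Nonempty ∧ ∀ x ∈ A, ∀ y ∈ A, x ⊆ y ∨ y ⊆ x).image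
    fun A => A.image enc

theorem enc_injective : Function.Injective enc :=
  Finset.geomSum_injective le_rfl

/-- The Barycentric refinement before relabelling: the nonempty chains of `G`. -/
def chains (G : Finset (Finset ℕ)) : Finset (Finset (Finset ℕ)) :=
  G.powerset.filter fun A => A.Nonempty ∧ ∀ x ∈ A, ∀ y ∈ A, x ⊆ y ∨ y ⊆ x

theorem mem_chains {G : Finset (Finset ℕ)} {A : Finset (Finset ℕ)} :
    A ∈ chains G ↔ A ⊆ G ∧ A.Nonempty ∧ ∀ x ∈ A, ∀ y ∈ A, x ⊆ y ∨ y ⊆ x := by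
  simp [chains]

theorem mem_bary {G : Finset (Finset ℕ)} {B : Finset ℕ} :
    B ∈ bary G ↔ ∃ A ∈ chains G, A.image enc = B := by
  simp only [bary, chains, Finset.mem_image]

theorem card_filter_bary (G : Finset (Finset ℕ)) (k : ℕ) :
    ((bary G).filter fun B => B.card = k).card =
      ((chains G).filter fun A => A.card = k).card := by
  have h : bary G = (chains G).image fun A => A.image enc := rfl
  rw [h, Finset.filter_image,
    Finset.card_image_of_injective _ (Finset.image_injective enc_injective)]
  simp only [Finset.card_image_of_injective _ enc_injective]

theorem IsComplex.bary {G : Finset (Finset ℕ)} : IsComplex (bary G) := by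
  constructor
  · intro B hB
    obtain ⟨A, hA, rfl⟩ := mem_bary.1 hB
    exact (mem_chains.1 hA).2.1.image _
  · intro B hB C hCB hC
    obtain ⟨A, hA, rfl⟩ := mem_bary.1 hB
    obtain ⟨D, hDA, rfl⟩ := Finset.subset_image_iff.1 hCB
    obtain ⟨hAG, -, hch⟩ := mem_chains.1 hA
    exact mem_bary.2 ⟨D, mem_chains.2 ⟨subset_trans (by exact_mod_cast hDA) hAG,
      Finset.image_nonempty.1 hC, fun x hx y hy => hch x (hDA hx) y (hDA hy)⟩, rfl⟩

theorem card_le_two_of_mem_bary {G : Finset (Finset ℕ)} (hG : IsComplex G)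
    (hmax : ∀ x ∈ G, x.card ≤ 2) : ∀ B ∈ bary G, B.card ≤ 2 := by
  intro B hB
  obtain ⟨A, hA, rfl⟩ := mem_bary.1 hB
  obtain ⟨hAG, -, hch⟩ := mem_chains.1 hA
  rw [Finset.card_image_of_injective _ enc_injective]
  have hcard : A.card ≤ (Finset.Icc 1 2).card := by
    refine Finset.card_le_card_of_injOn Finset.card ?_ ?_
    · intro x hx
      exact Finset.mem_coe.2 (Finset.mem_Icc.2
        ⟨(hG.1 x (hAG hx)).card_pos, hmax x (hAG hx)⟩)
    · intro x hx y hy hxy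
      rcases hch x hx y hy with h | h
      · exact Finset.eq_of_subset_of_card_le h hxy.ge
      · exact (Finset.eq_of_subset_of_card_le h hxy.le).symm
  simpa using hcard

theorem card_filter_chains_one (G : Finset (Finset ℕ)) :
    ((chains G).filter fun A => A.card = 1).card = G.card := by
  symm
  refine Finset.card_nbij (fun x => {x}) ?_ (fun x _ y _ h => by simpa using h) ?_
  · intro x hx
    simpa [mem_chains] using hx
  · intro A hA
    obtain ⟨hA, hA1⟩ := Finset.mem_filter.1 hA
    obtain ⟨x, rfl⟩ := Finset.card_eq_one.1 hA1
    exact ⟨x, by simpa using (mem_chains.1 hA).1, rfl⟩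

theorem card_filter_chains_two {G : Finset (Finset ℕ)} (hG : IsComplex G)
    (hmax : ∀ x ∈ G, x.card ≤ 2) :
    ((chains G).filter fun A => A.card = 2).card =
      2 * (G.filter fun x => x.card = 2).card := by
  have hflags : ((G.filter fun x => x.card = 2).sigma fun e => e).card =
      2 * (G.filter fun x => x.card = 2).card := by
    rw [Finset.card_sigma, Finset.sum_const_nat fun e he => (Finset.mem_filter.1 he).2, mul_comm]
  rw [← hflags]
  symm
  have hne : ∀ (e : Finset ℕ) (v : ℕ), e.card = 2 → {v} ≠ e := by
    rintro _ v he rfl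
    simp at he
  refine Finset.card_nbij (fun p => {{p.2}, p.1}) ?_ ?_ ?_
  · rintro ⟨e, v⟩ hp
    simp only [Finset.mem_sigma, Finset.mem_filter, Finset.mem_coe] at hp
    obtain ⟨⟨he, he2⟩, hv⟩ := hp
    have hvG : {v} ∈ G := hG.2 e he _ (by simpa using hv) (by simp)
    simp [mem_chains, Finset.insert_subset_iff, he, hvG, hv, Finset.card_pair (hne e v he2)]
  · rintro ⟨e, v⟩ hp ⟨e', v'⟩ hp' h
    simp only [Finset.mem_sigma, Finset.mem_filter, Finset.mem_coe] at hp hp'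
    have he : e ∈ ({{v'}, e'} : Finset (Finset ℕ)) := by
      simp only at h
      simp [← h]
    have hv : {v} ∈ ({{v'}, e'} : Finset (Finset ℕ)) := by
      simp only at h
      simp [← h]
    simp only [Finset.mem_insert, Finset.mem_singleton, Finset.singleton_inj,
      hne e' v hp'.1.2, (hne e v' hp.1.2).symm, false_or, or_false] at he hv
    subst he hv
    rfl
  · intro A hA
    rw [Finset.mem_coe, Finset.mem_filter, mem_chains] at hA
    obtain ⟨⟨hAG, -, hch⟩, hA2⟩ := hA
    obtain ⟨x, y, hxy, rfl⟩ := Finset.card_eq_two.1 hA2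
    wlog hsub : x ⊆ y generalizing x y
    · have hyx : y ⊆ x := (hch x (by simp) y (by simp)).resolve_left hsub
      rw [Finset.pair_comm] at *
      exact this y x hxy.symm hA2 hAG hch hyx
    have hxG : x ∈ G := hAG (by simp)
    have hyG : y ∈ G := hAG (by simp)
    have hlt : x.card < y.card := Finset.card_lt_card (hsub.ssubset_of_ne hxy)
    have hx0 := (hG.1 x hxG).card_pos
    have hy2 := hmax y hyG
    obtain ⟨v, rfl⟩ := Finset.card_eq_one.1 (show x.card = 1 by omega)
    refine ⟨⟨y, v⟩, ?_, rfl⟩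
    simp only [Finset.mem_sigma, Finset.mem_filter, Finset.mem_coe]
    exact ⟨⟨hyG, by omega⟩, by simpa using hsub⟩

theorem sum_eq_of_card_le_two {G : Finset (Finset ℕ)} (hG : IsComplex G)
    (hmax : ∀ x ∈ G, x.card ≤ 2) (f : ℕ → ℕ) :
    ∑ x ∈ G, f x.card = f 1 * (G.filter fun x => x.card = 1).card +
      f 2 * (G.filter fun x => x.card = 2).card := by
  have h : ∀ x ∈ G, f x.card =
      (if x.card = 1 then f 1 else 0) + (if x.card = 2 then f 2 else 0) := by
    intro x hx
    have h1 := (hG.1 x hx).card_pos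
    have h2 := hmax x hx
    obtain h | h : x.card = 1 ∨ x.card = 2 := by omega
    all_goals simp [h]
  rw [Finset.sum_congr rfl h, Finset.sum_add_distrib, ← Finset.sum_filter, ← Finset.sum_filter]
  simp [mul_comm]

theorem card_eq_of_card_le_two {G : Finset (Finset ℕ)} (hG : IsComplex G)
    (hmax : ∀ x ∈ G, x.card ≤ 2) :
    G.card = (G.filter fun x => x.card = 1).card + (G.filter fun x => x.card = 2).card := by
  simpa using sum_eq_of_card_le_two hG hmax fun _ => 1

theorem dimPlus_eq_of_card_le_two {G : Finset (Finset ℕ)} (hG : IsComplex G)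
    (hmax : ∀ x ∈ G, x.card ≤ 2) :
    DimPlus G = ((G.filter fun x => x.card = 1).card + 2 * (G.filter fun x => x.card = 2).card) /
      ((G.filter fun x => x.card = 1).card + (G.filter fun x => x.card = 2).card + 1) := by
  have h := sum_eq_of_card_le_two hG hmax id
  simp only [id, one_mul] at h
  rw [DimPlus, ← Nat.cast_sum, h, card_eq_of_card_le_two hG hmax]
  push_cast
  rfl

theorem iterate_bary_face_counts {G : Finset (Finset ℕ)} (hG : IsComplex G)
    (hmax : ∀ x ∈ G, x.card ≤ 2) (n : ℕ) :
    IsComplex (bary^[n] G) ∧ (∀ x ∈ bary^[n] G, x.card ≤ 2) ∧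
      ((bary^[n] G).filter fun x => x.card = 2).card =
        2 ^ n * (G.filter fun x => x.card = 2).card ∧
      ((bary^[n] G).filter fun x => x.card = 1).card + (G.filter fun x => x.card = 2).card =
        (G.filter fun x => x.card = 1).card + 2 ^ n * (G.filter fun x => x.card = 2).card := by
  induction n with
  | zero => exact ⟨hG, hmax, by simp, by simp⟩
  | succ n ih =>
    obtain ⟨hc, hle, hedges, hvertices⟩ := ih
    rw [Function.iterate_succ_apply']
    refine ⟨IsComplex.bary, card_le_two_of_mem_bary hc hle, ?_, ?_⟩
    · rw [card_filter_bary, card_filter_chains_two hc hle, hedges]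
      ring
    · rw [card_filter_bary, card_filter_chains_one, card_eq_of_card_le_two hc hle, hedges,
        add_right_comm, hvertices]
      ring

theorem tendsto_add_mul_div_add_mul {u : ℕ → ℝ} (hu : Filter.Tendsto u Filter.atTop Filter.atTop)
    (a b c d : ℝ) (hd : d ≠ 0) :
    Filter.Tendsto (fun n => (a + c * u n) / (b + d * u n)) Filter.atTop (nhds (c / d)) := by
  have hinv := tendsto_inv_atTop_zero.comp hu
  have hlim : Filter.Tendsto (fun n => (a * (u n)⁻¹ + c) / (b * (u n)⁻¹ + d))
      Filter.atTop (nhds ((a * 0 + c) / (b * 0 + d))) :=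
    ((hinv.const_mul a).add_const c).div ((hinv.const_mul b).add_const d) (by simpa using hd)
  rw [mul_zero, mul_zero, zero_add, zero_add] at hlim
  refine hlim.congr' ?_
  filter_upwards [hu.eventually_gt_atTop 0] with n hn
  rw [← mul_div_mul_right (a * (u n)⁻¹ + c) (b * (u n)⁻¹ + d) hn.ne', add_mul, add_mul,
    inv_mul_cancel_right₀ hn.ne', inv_mul_cancel_right₀ hn.ne']

/-- For every finite abstract simplicial complex of maximal dimension 1 (all
sets have at most 2 elements and some set has exactly 2 elements), the average
simplex cardinalities of the iterated Barycentric refinements converge to `3/2`. -/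
theorem bary_limit_dim_one (G : Finset (Finset ℕ)) (hG : IsComplex G)
    (hmax : ∀ x ∈ G, x.card ≤ 2) (hone : ∃ x ∈ G, x.card = 2) :
    Filter.Tendsto (fun n => ((DimPlus (bary^[n] G) : ℝ)))
      Filter.atTop (nhds (3 / 2)) := by
  set V := (G.filter fun x => x.card = 1).card
  set E := (G.filter fun x => x.card = 2).card with hE
  have hEpos : 0 < E := by
    obtain ⟨x, hx, hx2⟩ := hone
    exact Finset.card_pos.2 ⟨x, Finset.mem_filter.2 ⟨hx, hx2⟩⟩
  have hE0 : (E : ℝ) ≠ 0 := by exact_mod_cast hEpos.ne'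
  have hlim := tendsto_add_mul_div_add_mul
    (tendsto_pow_atTop_atTop_of_one_lt (one_lt_two : (1 : ℝ) < 2))
    (V - E) (V - E + 1) (3 * E) (2 * E) (mul_ne_zero two_ne_zero hE0)
  rw [mul_div_mul_right _ _ hE0] at hlim
  refine hlim.congr fun n => ?_
  obtain ⟨hc, hle, hedges, hvertices⟩ := iterate_bary_face_counts hG hmax n
  have hv : (((bary^[n] G).filter fun x => x.card = 1).card : ℝ) = V + 2 ^ n * E - E := by
    rw [eq_sub_iff_add_eq]
    exact_mod_cast hvertices
  rw [dimPlus_eq_of_card_le_two hc hle, hedges]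
  push_cast
  rw [hv]
  congr 1 <;> ring
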